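/- arXiv:2501.16790 — 3 statements merged into one kernel-verified Lean document; each statement's English description precedes it below -/
import Mathlib

section
/- Fix natural numbers D, K ≥ 1 and I ≥ 2, a sequence x : [I] → [D], context embeddings α : [D] → ℝ^K, and center embeddings ρ : [D] → ℝ^K. Consider the bidirectional self-attention model at position i ∈ [I] with the following parameters: context embeddings β_ℓ = α_ℓ for ℓ ∈ [D] and β_[MASK] = 0, all positional embeddings equal to 0, query and key matrices W^Q = W^K = 0 ∈ ℝ^{K×K}, value matrix W^V = Id_{K×K}, mask M = 0, and center embeddings δ_ℓ = (I/(I−1)) ρ_ℓ. That is, let X_i ∈ ℝ^{K×I} have j-th column α_{x_j} for j ≠ i and i-th column 0, let X_i' = W^V X_i · softmax((W^Q X_i)ᵀ W^K X_i / K), where softmax is applied column-wise, and let η_i := σ(δᵀ X'_{ii}) ∈ ℝ^D where X'_{ii} is the i-th column of X_i' and σ is the softmax over [D]. Then for every category d ∈ [D], (η_i)_d = exp( (1/(I−1)) ρ_dᵀ Σ_{j≠i} α_{x_j} ) / Σ_{d'∈[D]} exp( (1/(I−1)) ρ_{d'}ᵀ Σ_{j≠i} α_{x_j} ); i.e.,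 the attention model reduces to the linear latent factor model x_i | x_{−i} ∼ Categorical( σ( (1/(I−1)) ρᵀ Σ_{j≠i} α_{x_j} ) ). -/
open Matrix Finset

/-- With context embeddings `β_ℓ = α_ℓ`, zero mask embedding, zero positional embeddings,
zero query and key matrices, identity value matrix, zero mask, and center embeddings
`δ_d = (I/(I−1)) ρ_d`, the bidirectional self-attention categorical model at position `i`
reduces to the linear latent factor model
`x_i | x_{−i} ∼ Categorical(σ((1/(I−1)) ρᵀ Σ_{j≠i} α_{x_j}))`. -/
theorem attention_reduces_to_latent_factor_categorical
    (D K I : ℕ) (hD : 1 ≤ D) (hK : 1 ≤ K) (hI : 2 ≤ I)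
    (x : Fin I → Fin D) (α ρ : Fin D → Fin K → ℝ) (i : Fin I) :
    let Xi : Matrix (Fin K) (Fin I) ℝ := fun k j => if j = i then 0 else α (x j) k
    let Wq : Matrix (Fin K) (Fin K) ℝ := 0
    let Wk : Matrix (Fin K) (Fin K) ℝ := 0
    let Wv : Matrix (Fin K) (Fin K) ℝ := 1
    let scores : Matrix (Fin I) (Fin I) ℝ :=
      fun j l => (((Wq * Xi)ᵀ * (Wk * Xi)) j l) / K
    let S : Matrix (Fin I) (Fin I) ℝ :=
      fun j l => Real.exp (scores j l) / ∑ j' : Fin I, Real.exp (scores j' l)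
    let X' : Matrix (Fin K) (Fin I) ℝ := (Wv * Xi) * S
    let δ : Fin D → Fin K → ℝ := fun d => ((I : ℝ) / ((I : ℝ) - 1)) • ρ d
    let η : Fin D → ℝ := fun d =>
      Real.exp (∑ k : Fin K, δ d k * X' k i) /
        ∑ d' : Fin D, Real.exp (∑ k : Fin K, δ d' k * X' k i)
    ∀ d : Fin D,
      η d =
        Real.exp ((1 / ((I : ℝ) - 1)) *
            ∑ k : Fin K, ρ d k * ∑ j ∈ univ.filter (· ≠ i), α (x j) k) /
          ∑ d' : Fin D,
            Real.exp ((1 / ((I : ℝ) - 1)) *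
              ∑ k : Fin K, ρ d' k * ∑ j ∈ univ.filter (· ≠ i), α (x j) k) := by
  intro Xi Wq Wk Wv scores S X' δ η d
  have hI0 : (I : ℝ) ≠ 0 := by positivity
  have hS (j l : Fin I) : S j l = 1 / I := by
    simp [S, scores, Wq, Wk]
  have hX (k : Fin K) :
      X' k i = (1 / (I : ℝ)) * ∑ j ∈ univ.filter (· ≠ i), α (x j) k := by
    have hX' : X' = Xi * S := congrArg (· * S) (Matrix.one_mul Xi)
    rw [hX', Matrix.mul_apply, Finset.sum_filter]
    simp only [hS, ← Finset.sum_mul, ne_eq, ite_not, Xi, mul_comm]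
  have hlogit (d : Fin D) : ∑ k : Fin K, δ d k * X' k i =
      (1 / ((I : ℝ) - 1)) *
        ∑ k : Fin K, ρ d k * ∑ j ∈ univ.filter (· ≠ i), α (x j) k := by
    rw [Finset.mul_sum]
    refine Finset.sum_congr rfl fun k _ => ?_
    simp only [hX, δ, Pi.smul_apply, smul_eq_mul]
    field_simp
  simp only [η, hlogit]
end

section
/- Fix natural numbers K ≥ 1 and I ≥ 2, vectors v_1, …, v_I ∈ ℝ^K, real numbers y_1, …, y_I, and an index i ∈ [I]. Let Y ∈ ℝ^{(K+1)×I} be the matrix whose j-th column is (v_j; ỹ_j), where ỹ_j = y_j for j ≠ i and ỹ_i = 0. Let W^V = diag(0, …, 0, 1) ∈ ℝ^{(K+1)×(K+1)}, W^Q = W^K = diag(1, …, 1, 0) ∈ ℝ^{(K+1)×(K+1)} (with K ones), and define the linear-attention output Y' = (W^V Y) · ((W^Q Y)ᵀ (W^K Y)) / (K+1). Then (K+1) · (Y')_{K+1, i} = v_iᵀ Σ_{j≠i} v_j y_j. In particular, with v_j = h(τ_j) for an embedding map h, the EFA model for Gaussian spatiotemporal time series with these parameters and readout λ₂(z) = (K+1)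 z_{K+1} has conditional mean h(τ_i)ᵀ Σ_{j≠i} h(τ_j) y_j, i.e., it reduces to the linear latent factor model y_i | y_{−i} ∼ N( h(τ_i)ᵀ Σ_{j≠i} h(τ_j) y_j, σ² ). -/
open Matrix Finset

/-- Linear attention with value matrix `diag(0,…,0,1)` and query/key matrices
`diag(1,…,1,0)` applied to the masked input whose `j`-th column is `(v_j; ỹ_j)`
(with `ỹ_i = 0`) produces, in the `(K+1, i)` entry scaled by `K+1`, the quantity
`v_iᵀ Σ_{j≠i} v_j y_j`, i.e., the Gaussian spatiotemporal EFA model with these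
parameters reduces to the linear latent factor model. -/
theorem linear_attention_reduces_to_latent_factor_gaussian
    (K I : ℕ) (hK : 1 ≤ K) (hI : 2 ≤ I)
    (v : Fin I → Fin K → ℝ) (y : Fin I → ℝ) (i : Fin I) :
    let Y : Matrix (Fin (K + 1)) (Fin I) ℝ := fun r j =>
      if h : (r : ℕ) < K then v j ⟨r, h⟩ else (if j = i then 0 else y j)
    let Wv : Matrix (Fin (K + 1)) (Fin (K + 1)) ℝ :=
      Matrix.diagonal (fun r => if r = Fin.last K then 1 else 0)
    let Wq : Matrix (Fin (K + 1)) (Fin (K + 1)) ℝ :=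
      Matrix.diagonal (fun r => if r = Fin.last K then 0 else 1)
    let Wk : Matrix (Fin (K + 1)) (Fin (K + 1)) ℝ :=
      Matrix.diagonal (fun r => if r = Fin.last K then 0 else 1)
    let Y' : Matrix (Fin (K + 1)) (Fin I) ℝ :=
      (((K : ℝ) + 1)⁻¹) • ((Wv * Y) * ((Wq * Y)ᵀ * (Wk * Y)))
    ((K : ℝ) + 1) * Y' (Fin.last K) i =
      ∑ j ∈ univ.filter (· ≠ i), (∑ k : Fin K, v i k * v j k) * y j := by
  intro Y Wv Wq Wk Y'
  have hK0 : (K : ℝ) + 1 ≠ 0 := by positivity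
  have hV (j : Fin I) : (Wv * Y) (Fin.last K) j = if j = i then 0 else y j := by
    rw [Matrix.diagonal_mul]
    simp [Y]
  have hQ_last (j : Fin I) : (Wq * Y) (Fin.last K) j = 0 := by
    rw [Matrix.diagonal_mul]
    simp
  have hQ (k : Fin K) (j : Fin I) : (Wq * Y) k.castSucc j = v j k := by
    rw [Matrix.diagonal_mul]
    simp [Y, Fin.castSucc_ne_last]
  have hscore (j : Fin I) : ((Wq * Y)ᵀ * (Wk * Y)) j i = ∑ k : Fin K, v i k * v j k := by
    change ((Wq * Y)ᵀ * (Wq * Y)) j i = _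
    simp only [Matrix.mul_apply (M := (Wq * Y)ᵀ), Matrix.transpose_apply,
      Fin.sum_univ_castSucc, hQ, hQ_last, mul_zero, add_zero]
    exact Finset.sum_congr rfl fun k _ => mul_comm _ _
  change ((K : ℝ) + 1) *
    (((K : ℝ) + 1)⁻¹ • ((Wv * Y) * ((Wq * Y)ᵀ * (Wk * Y)))) (Fin.last K) i = _
  rw [Matrix.smul_apply, smul_eq_mul, mul_inv_cancel_left₀ hK0, Matrix.mul_apply,
    Finset.sum_filter]
  refine Finset.sum_congr rfl fun j _ => ?_
  rw [hV, hscore]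
  by_cases hj : j = i <;> simp [hj, mul_comm]
end

section
/- Fix natural numbers D, K ≥ 1 and I ≥ 2, a sequence x : [I] → [D], ratings y_1, …, y_I ∈ ℝ, center embeddings ρ : [D] → ℝ^K, context embeddings α : [D] → ℝ^K, and an index i ∈ [I]. Let Y ∈ ℝ^{(2K+1)×I} be the matrix whose j-th column is (ρ_{x_j}; (1/(I−1)) α_{x_j}; ỹ_j), where ỹ_j = y_j for j ≠ i and ỹ_i = 0. Let W^Q, W^K, W^V ∈ ℝ^{(2K+1)×(2K+1)} be the matrices acting on ℝ^K × ℝ^K × ℝ by W^Q(u, v, w) = (v, 0, 0), W^K(u, v, w) = (u, 0, 0), and W^V(u, v, w) = (0, 0, w), and define the linear-attention output Y' = (W^V Y) · ((W^Q Y)ᵀ (W^K Y)) / (2K+1). Then (2K+1) · (Y')_{2K+1, i} = (1/(I−1)) ρ_{x_i}ᵀ Σ_{j≠i} α_{x_j} y_j. In particular, with readout λ₂(z) = (2K+1) z_{2K+1}, the simplified EFA rating model with these parameters reduces to the linear latent factor model y_i − 1 | y_{−i} ∼ Poisson( exp( (1/(I−1)) ρ_{x_i}ᵀ Σ_{j≠i}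 α_{x_j} y_j ) ). -/
open Matrix Finset

/-- Linear attention with query, key, and value matrices acting on the block structure
`ℝ^K × ℝ^K × ℝ` by `W^Q(u,v,w) = (v,0,0)`, `W^K(u,v,w) = (u,0,0)`, `W^V(u,v,w) = (0,0,w)`,
applied to the masked input whose `j`-th column is `(ρ_{x_j}; (1/(I−1)) α_{x_j}; ỹ_j)`
(with `ỹ_i = 0`), produces in the `(2K+1, i)` entry scaled by `2K+1` the quantity
`(1/(I−1)) ρ_{x_i}ᵀ Σ_{j≠i} α_{x_j} y_j`, i.e., the simplified EFA rating model reduces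
to the linear latent factor model. -/
theorem linear_attention_reduces_to_latent_factor_rating
    (D K I : ℕ) (hD : 1 ≤ D) (hK : 1 ≤ K) (hI : 2 ≤ I)
    (x : Fin I → Fin D) (y : Fin I → ℝ)
    (ρ α : Fin D → Fin K → ℝ) (i : Fin I) :
    let Y : Matrix (Fin (2 * K + 1)) (Fin I) ℝ := fun r j =>
      if h : (r : ℕ) < K then ρ (x j) ⟨(r : ℕ), h⟩
      else if h2 : (r : ℕ) < 2 * K then
        (1 / ((I : ℝ) - 1)) * α (x j) ⟨(r : ℕ) - K, by omega⟩
      else (if j = i then 0 else y j)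
    let Wq : Matrix (Fin (2 * K + 1)) (Fin (2 * K + 1)) ℝ := fun r s =>
      if (r : ℕ) < K ∧ (s : ℕ) = (r : ℕ) + K then 1 else 0
    let Wk : Matrix (Fin (2 * K + 1)) (Fin (2 * K + 1)) ℝ := fun r s =>
      if (r : ℕ) < K ∧ s = r then 1 else 0
    let Wv : Matrix (Fin (2 * K + 1)) (Fin (2 * K + 1)) ℝ := fun r s =>
      if (r : ℕ) = 2 * K ∧ (s : ℕ) = 2 * K then 1 else 0
    let Y' : Matrix (Fin (2 * K + 1)) (Fin I) ℝ :=
      ((2 * (K : ℝ) + 1)⁻¹) • ((Wv * Y) * ((Wq * Y)ᵀ * (Wk * Y)))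
    (2 * (K : ℝ) + 1) * Y' ⟨2 * K, by omega⟩ i =
      (1 / ((I : ℝ) - 1)) *
        ∑ j ∈ univ.filter (· ≠ i), (∑ k : Fin K, ρ (x i) k * α (x j) k) * y j := by
  intro Y Wq Wk Wv Y'
  have hV (j : Fin I) : (Wv * Y) ⟨2 * K, by omega⟩ j = if j = i then 0 else y j := by
    rw [Matrix.mul_apply, Finset.sum_eq_single ⟨2 * K, by omega⟩]
    · have h : ¬ 2 * K < K := by omega
      simp [Wv, Y, h]
    · intro s _ hs
      have h : (s : ℕ) ≠ 2 * K := fun h => hs (Fin.ext h)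
      simp [Wv, h]
    · simp
  have hQ (k : Fin K) (j : Fin I) :
      (Wq * Y) ⟨k, by omega⟩ j = (1 / ((I : ℝ) - 1)) * α (x j) k := by
    rw [Matrix.mul_apply, Finset.sum_eq_single ⟨k + K, by omega⟩]
    · have h : (k : ℕ) + K < 2 * K := by omega
      simp [Wq, Y, h]
    · intro s _ hs
      have h : (s : ℕ) ≠ k + K := fun h => hs (Fin.ext h)
      simp [Wq, h]
    · simp
  have hK' (k : Fin K) (j : Fin I) : (Wk * Y) ⟨k, by omega⟩ j = ρ (x j) k := by
    rw [Matrix.mul_apply, Finset.sum_eq_single ⟨k, by omega⟩]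
    · simp [Wk, Y]
    · intro s _ hs
      simp [Wk, hs]
    · simp
  have hK0 (r : Fin (2 * K + 1)) (hr : ¬ (r : ℕ) < K) (j : Fin I) : (Wk * Y) r j = 0 := by
    rw [Matrix.mul_apply]
    simp [Wk, hr]
  have hQK (j : Fin I) : ((Wq * Y)ᵀ * (Wk * Y)) j i =
      (1 / ((I : ℝ) - 1)) * ∑ k : Fin K, ρ (x i) k * α (x j) k := by
    rw [Matrix.mul_apply, Finset.mul_sum]
    refine (Fintype.sum_of_injective (fun k : Fin K => (⟨k, by omega⟩ : Fin (2 * K + 1)))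
      (fun a b h => Fin.ext (Fin.mk.inj h)) _ _ (fun r hr => ?_) (fun k => ?_)).symm
    · rw [hK0 r (fun h => hr ⟨⟨r, h⟩, rfl⟩), mul_zero]
    · rw [Matrix.transpose_apply, hQ, hK']
      ring
  have hc : (2 * (K : ℝ) + 1) ≠ 0 := by positivity
  rw [show Y' = (2 * (K : ℝ) + 1)⁻¹ • ((Wv * Y) * ((Wq * Y)ᵀ * (Wk * Y))) from rfl,
    Matrix.smul_apply, smul_eq_mul, mul_inv_cancel_left₀ hc, Matrix.mul_apply,
    Finset.mul_sum, Finset.sum_filter]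
  refine Finset.sum_congr rfl fun j _ => ?_
  rw [hV, hQK]
  by_cases h : j = i
  · simp [h]
  · simp only [h, if_false, ne_eq, not_false_eq_true, if_true]
    ring
end
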